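/- Let q ≥ 2 and k, ℓ ≥ 2 be integers. For every n ≥ 2k+ℓ−1: |{x ∈ Z_q^n : Δ_k(R_ℓ(x)) does not contain the factor 0^k}| ≤ |{N_{k,ℓ}(x) : x ∈ Z_q^n}| ≤ n²·|F_{k,ℓ}(n)|. -/

import Mathlib

/-- The composition of a word over `Fin q`, as an element of `ℤ^q`:
it counts, for each letter `a`, the number of occurrences of `a`. -/
def comp {q : ℕ} (w : List (Fin q)) : Fin q → ℤ := fun a => (w.count a : ℤ)

/-- The `ℓ`-read vector of a word over `Fin q`: a word of length `n + ℓ - 1`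
over `ℤ^q` whose `p`-th entry is the composition of the window of the last `ℓ`
symbols ending at position `p` (symbols outside the word are omitted). -/
def readVec {q : ℕ} (ℓ : ℕ) (x : List (Fin q)) : List (Fin q → ℤ) :=
  (List.range (x.length + ℓ - 1)).map fun p => comp ((x.take (p + 1)).drop (p + 1 - ℓ))

/-- The `k`-step derivative of a word over an abelian group, with the
convention that entries at nonpositive positions are `0`. -/
def kderiv {G : Type*} [AddCommGroup G] (k : ℕ) (y : List G) : List G :=
  (List.range y.length).map fun i => y.getD i 0 - if k ≤ i then y.getD (i - k) 0 else 0

/-- The lengths `(m_0, m_1, ..., m_s)` of the maximal (possibly empty) runs of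
zeros in `y = 0^{m_0} y_1 0^{m_1} ⋯ y_s 0^{m_s}` with `y_1, ..., y_s ≠ 0`. -/
def zeroRuns {G : Type*} [Zero G] [DecidableEq G] (y : List G) : List ℕ :=
  (y.splitOnP fun a => decide (a ≠ 0)).map List.length

/-- `σ_k(y) = (⌊m_0/k⌋, ⌊m_1/k⌋, ..., ⌊m_s/k⌋)`. -/
def sigmak {G : Type*} [Zero G] [DecidableEq G] (k : ℕ) (y : List G) : List ℕ :=
  (zeroRuns y).map fun m => m / k

/-- Interleave zero runs of the given lengths with the given (nonzero) letters:
`assemble (m_0 :: ... :: m_s) (y_1 :: ... :: y_s) = 0^{m_0} y_1 0^{m_1} ⋯ y_s 0^{m_s}`. -/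
def assemble {G : Type*} [Zero G] : List ℕ → List G → List G
  | [], _ => []
  | m :: _, [] => List.replicate m (0 : G)
  | m :: ms, a :: as => List.replicate m (0 : G) ++ a :: assemble ms as

/-- `μ_k(y) = 0^{m_0 % k} y_1 0^{m_1 % k} ⋯ y_s 0^{m_s % k}`. -/
def muk {G : Type*} [Zero G] [DecidableEq G] (k : ℕ) (y : List G) : List G :=
  assemble ((zeroRuns y).map fun m => m % k) (y.filter fun a => decide (a ≠ 0))

/-- The nucleus `N_{k,ℓ}(x) = μ_k(Δ_k(R_ℓ(x)))` of a word over `Fin q`. -/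
def nucleus {q : ℕ} (k ℓ : ℕ) (x : List (Fin q)) : List (Fin q → ℤ) :=
  muk k (kderiv k (readVec ℓ x))

/-- A single tandem duplication of length `k`: `u v w ↦ u v v w` with `|v| = k`. -/
def TD {α : Type*} (k : ℕ) (y z : List α) : Prop :=
  ∃ u v w : List α, v.length = k ∧ y = u ++ (v ++ w) ∧ z = u ++ (v ++ (v ++ w))

/-- `TDt k t y z` holds iff `z` arises from `y` by a sequence of exactly `t`
tandem duplications of length `k`, i.e. `y ⟹_k^t z`. -/
def TDt {α : Type*} (k : ℕ) : ℕ → List α → List α → Prop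
  | 0 => fun y z => y = z
  | t + 1 => fun y z => ∃ w, TDt k t y w ∧ TD k w z

/-- The ball `B_{k,t}(y)`: all words obtained from `y` by at most `t` tandem
duplications of length `k`. -/
def Ball {α : Type*} (k t : ℕ) (y : List α) : Set (List α) :=
  {z | ∃ j ≤ t, TDt k j y z}

/-- `x` is `(k,ℓ)`-fine: it contains no `k`-periodic factor of length `2k+ℓ-1`. -/
def Fine {q : ℕ} (k ℓ : ℕ) (x : List (Fin q)) : Prop :=
  ∀ i : ℕ, 1 ≤ i → i + 2 * k + ℓ - 2 ≤ x.length →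
    (x.drop (i - 1)).take (k + ℓ - 1) ≠ (x.drop (i - 1 + k)).take (k + ℓ - 1)

/-- `y` contains the factor `0^k` (a run of `k` consecutive zeros). -/
def HasZeroBlock {G : Type*} [Zero G] (k : ℕ) (y : List G) : Prop :=
  ∃ j, j + k ≤ y.length ∧ (y.drop j).take k = List.replicate k (0 : G)

/-- `λ_{m,q}`: the largest real root of `x^{m+2} - q·x^{m+1} + q - 1`. -/
noncomputable def lambdaRoot (m q : ℕ) : ℝ :=
  sSup {x : ℝ | x ^ (m + 2) - (q : ℝ) * x ^ (m + 1) + (q : ℝ) - 1 = 0}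

/-- The dot product `a ⊙ b = Σ_{i=1}^{min(|a|,|b|)} a_i · b_i`. -/
def dot {G : Type*} [AddCommMonoid G] (a : List ℕ) (b : List G) : G :=
  (List.zipWith (fun m g => m • g) a b).sum

section ZeroRuns

variable {G : Type*} [Zero G] [DecidableEq G]

theorem zeroRuns_nil : zeroRuns ([] : List G) = [0] := by
  simp [zeroRuns]

theorem zeroRuns_zero_cons (y : List G) :
    zeroRuns (0 :: y) = (zeroRuns y).modifyHead (· + 1) := by
  unfold zeroRuns
  rw [List.splitOnP_cons_eq_if_modifyHead]
  cases (y.splitOnP fun a => decide (a ≠ 0)) <;> simp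

theorem zeroRuns_cons_of_ne {a : G} (ha : a ≠ 0) (y : List G) :
    zeroRuns (a :: y) = 0 :: zeroRuns y := by
  simp [zeroRuns, List.splitOnP_cons_eq_if_modifyHead, ha]

theorem zeroRuns_ne_nil (y : List G) : zeroRuns y ≠ [] := by
  simp [zeroRuns]

theorem assemble_zeroRuns (y : List G) :
    assemble (zeroRuns y) (y.filter fun a => decide (a ≠ 0)) = y := by
  induction y with
  | nil => simp [zeroRuns_nil, assemble]
  | cons a y ih =>
    obtain ⟨m, ms, h⟩ := List.exists_cons_of_ne_nil (zeroRuns_ne_nil y)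
    by_cases ha : a = 0
    · subst ha
      rw [zeroRuns_zero_cons, List.filter_cons_of_neg (by simp)]
      conv_rhs => rw [← ih]
      rw [h]
      cases (y.filter fun a => decide (a ≠ 0)) <;> simp [assemble, List.replicate_succ]
    · rw [zeroRuns_cons_of_ne ha, List.filter_cons_of_pos (by simpa using ha)]
      simpa [assemble] using ih

theorem replicate_prefix_and_infix_of_zeroRuns (y : List G) {m : ℕ} {ms : List ℕ}
    (h : zeroRuns y = m :: ms) :
    List.replicate m (0 : G) <+: y ∧ ∀ r ∈ ms, List.replicate r (0 : G) <:+: y := by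
  induction y generalizing m ms with
  | nil =>
    rw [zeroRuns_nil] at h
    obtain ⟨rfl, rfl⟩ := List.cons.inj h
    simp
  | cons a y ih =>
    obtain ⟨m', ms', h'⟩ := List.exists_cons_of_ne_nil (zeroRuns_ne_nil y)
    obtain ⟨hp, hi⟩ := ih h'
    by_cases ha : a = 0
    · subst ha
      rw [zeroRuns_zero_cons, h', List.modifyHead_cons] at h
      obtain ⟨rfl, rfl⟩ := List.cons.inj h
      refine ⟨?_, fun r hr => (hi r hr).trans (List.suffix_cons _ _).isInfix⟩
      rw [List.replicate_succ]
      exact (List.prefix_cons_inj _).2 hp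
    · rw [zeroRuns_cons_of_ne ha, h'] at h
      obtain ⟨rfl, rfl⟩ := List.cons.inj h
      refine ⟨by simp, fun r hr => ?_⟩
      refine List.IsInfix.trans ?_ (List.suffix_cons a y).isInfix
      rcases List.mem_cons.1 hr with rfl | hr
      · exact hp.isInfix
      · exact hi r hr

theorem replicate_infix_of_mem_zeroRuns {y : List G} {m : ℕ} (hm : m ∈ zeroRuns y) :
    List.replicate m (0 : G) <:+: y := by
  obtain ⟨m', ms, h⟩ := List.exists_cons_of_ne_nil (zeroRuns_ne_nil y)
  obtain ⟨hp, hi⟩ := replicate_prefix_and_infix_of_zeroRuns y h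
  rw [h] at hm
  rcases List.mem_cons.1 hm with rfl | hm
  · exact hp.isInfix
  · exact hi m hm

theorem lt_of_mem_zeroRuns {k : ℕ} {y : List G} (hy : ¬HasZeroBlock k y) {m : ℕ}
    (hm : m ∈ zeroRuns y) : m < k := by
  by_contra! hkm
  obtain ⟨s, t, h⟩ := replicate_infix_of_mem_zeroRuns hm
  refine hy ⟨s.length, ?_, ?_⟩
  · rw [← h]
    simp only [List.length_append, List.length_replicate]
    omega
  · rw [← h]
    simp [List.take_append, hkm]

theorem muk_eq_self {k : ℕ} {y : List G} (hy : ¬HasZeroBlock k y) : muk k y = y := by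
  have h : (zeroRuns y).map (fun m => m % k) = zeroRuns y := by
    conv_rhs => rw [← List.map_id (zeroRuns y)]
    exact List.map_congr_left fun m hm => Nat.mod_eq_of_lt (lt_of_mem_zeroRuns hy hm)
  rw [muk, h, assemble_zeroRuns]

theorem zeroRuns_replicate_append (k : ℕ) (y : List G) :
    zeroRuns (List.replicate k 0 ++ y) = (zeroRuns y).modifyHead (· + k) := by
  obtain ⟨m, ms, h⟩ := List.exists_cons_of_ne_nil (zeroRuns_ne_nil y)
  induction k with
  | zero => simp [h]
  | succ k ih =>
    rw [List.replicate_succ, List.cons_append, zeroRuns_zero_cons, ih, h]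
    simp [Nat.add_assoc]

theorem map_mod_zeroRuns_append_congr (k : ℕ) (A : List G) {B C : List G}
    (h : (zeroRuns B).map (· % k) = (zeroRuns C).map (· % k)) :
    (zeroRuns (A ++ B)).map (· % k) = (zeroRuns (A ++ C)).map (· % k) := by
  induction A with
  | nil => simpa using h
  | cons a A ih =>
    rw [List.cons_append, List.cons_append]
    by_cases ha : a = 0
    · subst ha
      rw [zeroRuns_zero_cons, zeroRuns_zero_cons]
      obtain ⟨m, ms, hB⟩ := List.exists_cons_of_ne_nil (zeroRuns_ne_nil (A ++ B))
      obtain ⟨m', ms', hC⟩ := List.exists_cons_of_ne_nil (zeroRuns_ne_nil (A ++ C))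
      rw [hB, hC, List.map_cons, List.map_cons] at ih
      obtain ⟨h1, h2⟩ := List.cons.inj ih
      rw [hB, hC, List.modifyHead_cons, List.modifyHead_cons, List.map_cons, List.map_cons, h2,
        Nat.add_mod m, Nat.add_mod m', h1]
    · rw [zeroRuns_cons_of_ne ha, zeroRuns_cons_of_ne ha, List.map_cons, List.map_cons, ih]

theorem muk_append_replicate_append (k : ℕ) (A B : List G) :
    muk k (A ++ (List.replicate k 0 ++ B)) = muk k (A ++ B) := by
  have h : (zeroRuns (List.replicate k 0 ++ B)).map (· % k) = (zeroRuns B).map (· % k) := by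
    rw [zeroRuns_replicate_append]
    obtain ⟨m, ms, h⟩ := List.exists_cons_of_ne_nil (zeroRuns_ne_nil B)
    simp [h]
  rw [muk, muk, map_mod_zeroRuns_append_congr k A h]
  congr 1
  simp

end ZeroRuns

theorem kderiv_injective_of_length {G : Type*} [AddCommGroup G] {k : ℕ} (hk : 0 < k)
    {y z : List G} (hlen : y.length = z.length) (h : kderiv k y = kderiv k z) : y = z := by
  have key : ∀ i, y.getD i 0 = z.getD i 0 := by
    intro i
    induction i using Nat.strong_induction_on with
    | _ i ih =>
      by_cases hi : i < y.length
      · have h' := congrArg (fun l => l[i]?) h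
        simp only [kderiv, List.getElem?_map, List.getElem?_range hi,
          List.getElem?_range (hlen ▸ hi), Option.map_some, Option.some.injEq] at h'
        by_cases hki : k ≤ i
        · rw [if_pos hki, if_pos hki, ih (i - k) (by omega)] at h'
          exact sub_left_injective h'
        · simpa only [if_neg hki, sub_zero] using h'
      · rw [List.getD_eq_default _ _ (by omega), List.getD_eq_default _ _ (by omega)]
  refine List.ext_getElem hlen fun i h1 h2 => ?_
  simpa [List.getD_eq_getElem, h1, h2] using key i

section ReadVec

variable {q : ℕ}

theorem comp_append (u v : List (Fin q)) : comp (u ++ v) = comp u + comp v := by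
  ext a
  simp [comp]

theorem comp_singleton_injective {a b : Fin q} (h : comp [a] = comp [b]) : a = b := by
  by_contra hab
  have := congrFun h a
  simp [comp, Ne.symm hab] at this

theorem readVec_length (ℓ : ℕ) (x : List (Fin q)) :
    (readVec ℓ x).length = x.length + ℓ - 1 := by
  simp [readVec]

theorem readVec_getD (ℓ : ℕ) (x : List (Fin q)) {p : ℕ} (hp : p < x.length + ℓ - 1) :
    (readVec ℓ x).getD p 0 = comp ((x.take (p + 1)).drop (p + 1 - ℓ)) := by
  simp [readVec, List.getD, hp]

theorem readVec_injective_of_length {ℓ : ℕ} (hl : 0 < ℓ) {x z : List (Fin q)}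
    (hlen : x.length = z.length) (h : readVec ℓ x = readVec ℓ z) : x = z := by
  have key : ∀ p ≤ x.length, x.take p = z.take p := by
    intro p
    induction p with
    | zero => simp
    | succ p ih =>
      intro hp
      have ih := ih (by omega)
      have h' := congrArg (fun l => l.getD p 0) h
      rw [readVec_getD _ _ (by omega), readVec_getD _ _ (by omega),
        List.take_succ_eq_append_getElem (by omega), List.take_succ_eq_append_getElem (by omega),
        List.drop_append_of_le_length (by simp; omega),
        List.drop_append_of_le_length (by simp; omega),
        comp_append, comp_append, ih] at h'
      rw [List.take_succ_eq_append_getElem (by omega), List.take_succ_eq_append_getElem (by omega),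
        ih, comp_singleton_injective (add_left_cancel h')]
  have := key x.length le_rfl
  rwa [List.take_length, hlen, List.take_length] at this

theorem kderiv_readVec_getElem (k ℓ : ℕ) (x : List (Fin q)) {p : ℕ}
    (hp : p < (kderiv k (readVec ℓ x)).length) :
    (kderiv k (readVec ℓ x))[p] = comp ((x.take (p + 1)).drop (p + 1 - ℓ)) -
      if k ≤ p then comp ((x.take (p - k + 1)).drop (p - k + 1 - ℓ)) else 0 := by
  have hp' : p < x.length + ℓ - 1 := by simpa [kderiv, readVec] using hp
  simp only [kderiv, List.getElem_map, List.getElem_range]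
  rw [readVec_getD _ _ hp', readVec_getD _ _ (by omega)]

theorem nucleus_erase_period {k ℓ a : ℕ} (hl : 0 < ℓ) (x : List (Fin q))
    (hlen : a + 2 * k + ℓ - 1 ≤ x.length)
    (hper : (x.drop a).take (k + ℓ - 1) = (x.drop (a + k)).take (k + ℓ - 1)) :
    nucleus k ℓ (x.take a ++ x.drop (a + k)) = nucleus k ℓ x := by
  set x' := x.take a ++ x.drop (a + k) with hx'
  set c := a + k + ℓ - 1 with hc
  have hlen' : x'.length + k = x.length := by
    simp [hx']
    omega
  have htake : x'.take c = x.take c := by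
    have h1 : c = a + (k + ℓ - 1) := by omega
    rw [h1, List.take_add, hx', List.take_append_of_le_length (by simp; omega),
      List.drop_append_of_le_length (by simp; omega), List.take_add, hper]
    simp
  have hdrop : ∀ j, a ≤ j → x'.drop j = x.drop (j + k) := by
    intro j hj
    obtain ⟨i, rfl⟩ := Nat.exists_eq_add_of_le hj
    rw [← List.drop_drop, hx', List.drop_append_of_le_length (by simp; omega)]
    simp [List.drop_drop]
    congr 1
    omega
  have hleft : ∀ p < c, (x'.take (p + 1)).drop (p + 1 - ℓ) = (x.take (p + 1)).drop (p + 1 - ℓ) := by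
    intro p hp
    have : x'.take (p + 1) = x.take (p + 1) := by
      have := congrArg (List.take (p + 1)) htake
      rwa [List.take_take, List.take_take, min_eq_left (by omega)] at this
    rw [this]
  have hright : ∀ p, a + ℓ - 1 ≤ p →
      (x'.take (p + 1)).drop (p + 1 - ℓ) = (x.take (p + k + 1)).drop (p + k + 1 - ℓ) := by
    intro p hp
    rw [List.drop_take, List.drop_take, hdrop _ (by omega)]
    have e1 : p + 1 - ℓ + k = p + k + 1 - ℓ := by omega
    have e2 : p + 1 - (p + 1 - ℓ) = p + k + 1 - (p + k + 1 - ℓ) := by omega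
    rw [e1, e2]
  set y := kderiv k (readVec ℓ x) with hy
  set y' := kderiv k (readVec ℓ x') with hy'
  have hyl : y.length = x.length + ℓ - 1 := by simp [hy, kderiv, readVec]
  have hyl' : y'.length = x'.length + ℓ - 1 := by simp [hy', kderiv, readVec]
  have hA : y'.take c = y.take c := by
    refine List.ext_getElem (by simp; omega) fun p h1 h2 => ?_
    simp only [List.length_take] at h1 h2
    rw [List.getElem_take, List.getElem_take, kderiv_readVec_getElem, kderiv_readVec_getElem,
      hleft p (by omega), hleft (p - k) (by omega)]
  have hB : y'.drop c = y.drop (c + k) := by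
    refine List.ext_getElem (by simp; omega) fun p h1 h2 => ?_
    simp only [List.length_drop] at h1 h2
    rw [List.getElem_drop, List.getElem_drop, kderiv_readVec_getElem, kderiv_readVec_getElem,
      hright (c + p) (by omega), if_pos (by omega), if_pos (by omega),
      hright (c + p - k) (by omega)]
    have e1 : c + p + k = c + k + p := by omega
    have e2 : c + p - k + k = c + k + p - k := by omega
    rw [e1, e2]
  have hZ : (y.drop c).take k = List.replicate k 0 := by
    refine List.ext_getElem (by simp; omega) fun p h1 h2 => ?_
    simp only [List.length_replicate] at h2
    rw [List.getElem_take, List.getElem_drop, kderiv_readVec_getElem, if_pos (by omega),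
      ← hleft (c + p - k) (by omega), hright (c + p - k) (by omega), Nat.sub_add_cancel (by omega),
      sub_self, List.getElem_replicate]
  have hsplit : y = y.take c ++ (List.replicate k 0 ++ y.drop (c + k)) := by
    rw [← hZ, ← List.drop_drop, List.take_append_drop, List.take_append_drop]
  rw [nucleus, nucleus, ← hy, ← hy', hsplit, muk_append_replicate_append, ← hA, ← hB,
    List.take_append_drop]

theorem exists_fine_nucleus_eq {k ℓ : ℕ} (hk : 0 < k) (hl : 0 < ℓ) (x : List (Fin q)) :
    ∃ z : List (Fin q), z.length ≤ x.length ∧ Fine k ℓ z ∧ nucleus k ℓ z = nucleus k ℓ x := by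
  induction hN : x.length using Nat.strong_induction_on generalizing x with
  | _ N ih =>
    by_cases hx : Fine k ℓ x
    · exact ⟨x, hN.le, hx, rfl⟩
    · simp only [Fine, not_forall, not_not] at hx
      obtain ⟨i, hi, hlen, hper⟩ := hx
      have hlt : (x.take (i - 1) ++ x.drop (i - 1 + k)).length < N := by
        simp
        omega
      obtain ⟨z, hz, hfine, hnuc⟩ := ih _ hlt _ rfl
      exact ⟨z, hz.trans hlt.le, hfine,
        hnuc.trans (nucleus_erase_period hl x (by omega) hper)⟩

theorem Fine.exists_concat {k ℓ : ℕ} (hq : 2 ≤ q) (hk : 0 < k) (hl : 0 < ℓ) {x : List (Fin q)}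
    (hx : Fine k ℓ x) : ∃ b, Fine k ℓ (x ++ [b]) := by
  have : Nontrivial (Fin q) := Fin.nontrivial_iff_two_le.2 hq
  obtain ⟨b, hb⟩ : ∃ b, x[x.length - k]? ≠ some b := by
    cases x[x.length - k]? with
    | none => exact ⟨⟨0, by omega⟩, by simp⟩
    | some c =>
      obtain ⟨b, hb⟩ := exists_ne c
      exact ⟨b, by simpa using hb.symm⟩
  refine ⟨b, fun i hi hlen hper => ?_⟩
  rw [List.length_append, List.length_singleton] at hlen
  by_cases hlast : i + 2 * k + ℓ - 2 ≤ x.length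
  · refine hx i hi hlast ?_
    rwa [List.drop_append_of_le_length (by omega), List.drop_append_of_le_length (by omega),
      List.take_append_of_le_length (by simp; omega),
      List.take_append_of_le_length (by simp; omega)] at hper
  · have h := congrArg (fun l => l[k + ℓ - 2]?) hper
    beta_reduce at h
    rw [List.getElem?_take_of_lt (by omega), List.getElem?_take_of_lt (by omega),
      List.getElem?_drop, List.getElem?_drop, List.getElem?_append_left (by omega)] at h
    have e1 : i - 1 + (k + ℓ - 2) = x.length - k := by omega
    have e2 : i - 1 + k + (k + ℓ - 2) = x.length := by omega
    rw [e1, e2, List.getElem?_concat_length] at h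
    exact hb h

theorem Fine.exists_extension {k ℓ : ℕ} (hq : 2 ≤ q) (hk : 0 < k) (hl : 0 < ℓ)
    {x : List (Fin q)} (hx : Fine k ℓ x) {n : ℕ} (hn : x.length ≤ n) :
    ∃ z : List (Fin q), z.length = n ∧ Fine k ℓ z ∧ x <+: z := by
  induction n, hn using Nat.le_induction with
  | base => exact ⟨x, rfl, hx, List.prefix_rfl⟩
  | succ n _ ih =>
    obtain ⟨z, hz, hfine, hpre⟩ := ih
    obtain ⟨b, hb⟩ := hfine.exists_concat hq hk hl
    exact ⟨z ++ [b], by simp [hz], hb, hpre.trans (List.prefix_append _ _)⟩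

end ReadVec

/-- for every `n ≥ 2k+ℓ−1`,
`|{x : Δ_k(R_ℓ(x)) contains no factor 0^k}| ≤ |{N_{k,ℓ}(x) : x ∈ Z_q^n}| ≤ n²·|F_{k,ℓ}(n)|`. -/
theorem stmt_10 (q k ℓ : ℕ) (hq : 2 ≤ q) (hk : 2 ≤ k) (hl : 2 ≤ ℓ) (n : ℕ)
    (hn : 2 * k + ℓ - 1 ≤ n) :
    Nat.card {x : Fin n → Fin q //
        ¬HasZeroBlock k (kderiv k (readVec ℓ (List.ofFn x)))} ≤
      Set.ncard (Set.range fun x : Fin n → Fin q => nucleus k ℓ (List.ofFn x)) ∧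
      Set.ncard (Set.range fun x : Fin n → Fin q => nucleus k ℓ (List.ofFn x)) ≤
        n ^ 2 * Nat.card {x : Fin n → Fin q // Fine k ℓ (List.ofFn x)} := by
  have hfin : (Set.range fun x : Fin n → Fin q => nucleus k ℓ (List.ofFn x)).Finite :=
    Set.finite_range _
  constructor
  · rw [← Nat.card_coe_set_eq]
    have := hfin.to_subtype
    refine Nat.card_le_card_of_injective
      (fun x => (⟨nucleus k ℓ (List.ofFn x.1), x.1, rfl⟩ :
        Set.range fun x : Fin n → Fin q => nucleus k ℓ (List.ofFn x))) ?_
    rintro ⟨x, hx⟩ ⟨z, hz⟩ h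
    have h : nucleus k ℓ (List.ofFn x) = nucleus k ℓ (List.ofFn z) := congrArg Subtype.val h
    rw [nucleus, nucleus, muk_eq_self hx, muk_eq_self hz] at h
    have h := kderiv_injective_of_length (by omega) (by simp [readVec_length]) h
    have h := readVec_injective_of_length (by omega) (by simp) h
    exact Subtype.ext (List.ofFn_injective h)
  · let g : Fin (n + 1) × {x : Fin n → Fin q // Fine k ℓ (List.ofFn x)} → List (Fin q → ℤ) :=
      fun p => nucleus k ℓ ((List.ofFn p.2.1).take p.1)
    have hsub : (Set.range fun x : Fin n → Fin q => nucleus k ℓ (List.ofFn x)) ⊆ Set.range g := by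
      rintro _ ⟨x, rfl⟩
      obtain ⟨w, hw, hfine, hnuc⟩ :=
        exists_fine_nucleus_eq (k := k) (ℓ := ℓ) (by omega) (by omega) (List.ofFn x)
      rw [List.length_ofFn] at hw
      obtain ⟨z, rfl, hz, hpre⟩ := hfine.exists_extension hq (by omega) (by omega) hw
      refine ⟨(⟨w.length, by omega⟩, ⟨z.get, by rwa [List.ofFn_get]⟩), ?_⟩
      simp only [g, List.ofFn_get]
      rw [← List.prefix_iff_eq_take.1 hpre, hnuc]
    calc _ ≤ (Set.range g).ncard := Set.ncard_le_ncard hsub (Set.finite_range g)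
      _ ≤ Nat.card (Fin (n + 1) × {x : Fin n → Fin q // Fine k ℓ (List.ofFn x)}) := by
        rw [← Nat.card_coe_set_eq]
        exact Finite.card_range_le g
      _ = (n + 1) * Nat.card {x : Fin n → Fin q // Fine k ℓ (List.ofFn x)} := by
        rw [Nat.card_prod, Nat.card_fin]
      _ ≤ _ := Nat.mul_le_mul_right _ (by nlinarith [show 5 ≤ n by omega])
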